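/- Let K be an infinite field of characteristic different from 2 which is cyclic, and let E be an elliptic curve over K (this is the one-dimensional case of the paper's Density Theorem, which asserts Zariski-density of rational points; on a one-dimensional group variety Zariski-density is equivalent to infinitude). Then the group E(K) of K-rational points of E is infinite. -/

import Mathlib

def IsCyclicField (K : Type) [Field K] : Prop :=
  ∀ (L : Type) [Field L] [Algebra K L] [FiniteDimensional K L] [IsGalois K L],
    IsCyclic (L ≃ₐ[K] L)

open Polynomial Filter

/-- For a separable polynomial over a cyclic field there is a splitting extension with an
automorphism whose fixed elements lie in the base field. -/
theorem exists_gen {K : Type} [Field K] (hcyc : IsCyclicField K) (p : K[X]) (hp : p.Separable) :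
    ∃ (L : Type) (_ : Field L) (_ : Algebra K L) (σ : L ≃ₐ[K] L),
      (p.map (algebraMap K L)).Splits ∧ ∀ x : L, σ x = x → ∃ y : K, algebraMap K L y = x := by
  have : IsGalois K p.SplittingField := IsGalois.of_separable_splitting_field hp
  obtain ⟨σ, hσ⟩ := (hcyc p.SplittingField).exists_generator
  refine ⟨p.SplittingField, inferInstance, inferInstance, σ, SplittingField.splits p, ?_⟩
  intro x hx
  have : ∀ τ : p.SplittingField ≃ₐ[K] p.SplittingField, τ x = x := by
    intro τ
    have h := hσ τ
    have : Subgroup.zpowers σ ≤ MulAction.stabilizer (p.SplittingField ≃ₐ[K] p.SplittingField) x := by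
      rw [Subgroup.zpowers_le]
      exact hx
    exact this h
  exact (IsGalois.mem_range_algebraMap_iff_fixed x).2 this

theorem exists_root_of_splits {K L : Type} [Field K] [Field L] [Algebra K L] (p q : K[X])
    (hpq : p ∣ q) (hq0 : q ≠ 0) (hd : p.degree ≠ 0)
    (h : (q.map (algebraMap K L)).Splits) : ∃ x : L, aeval x p = 0 := by
  have h1 : (p.map (algebraMap K L)).Splits :=
    h.of_dvd (by rwa [Ne, Polynomial.map_eq_zero]) (Polynomial.map_dvd _ hpq)
  obtain ⟨x, hx⟩ := h1.exists_eval_eq_zero (by rwa [degree_map])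
  exact ⟨x, by rwa [eval_map_algebraMap] at hx⟩

theorem sq_class {K : Type} [Field K] (h2 : (2 : K) ≠ 0) (hcyc : IsCyclicField K) (a b : K)
    (ha : ¬ IsSquare a) (hb : ¬ IsSquare b) : IsSquare (a * b) := by
  by_cases hab : a = b
  · exact ⟨a, by rw [hab]⟩
  have ha0 : a ≠ 0 := fun h => ha (h ▸ IsSquare.zero)
  have hb0 : b ≠ 0 := fun h => hb (h ▸ IsSquare.zero)
  have hs : ((X ^ 2 - C a : K[X]) * (X ^ 2 - C b)).Separable := by
    refine Separable.mul (separable_X_pow_sub_C a (by exact_mod_cast h2) ha0)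
      (separable_X_pow_sub_C b (by exact_mod_cast h2) hb0) ?_
    refine ⟨C (1 / (b - a)), - C (1 / (b - a)), ?_⟩
    have : C (1 / (b - a)) * (C b - C a) = (1 : K[X]) := by
      rw [← C_sub, ← C_mul, one_div_mul_cancel (sub_ne_zero.2 (Ne.symm hab)), C_1]
    linear_combination this
  obtain ⟨L, _, _, σ, hsp, hfix⟩ := exists_gen hcyc _ hs
  obtain ⟨α, hα⟩ := exists_root_of_splits _ _ (Dvd.intro _ rfl) hs.ne_zero
    (by rw [degree_X_pow_sub_C (by norm_num)]; norm_num) hsp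
  obtain ⟨β, hβ⟩ := exists_root_of_splits _ _ (Dvd.intro_left _ rfl) hs.ne_zero
    (by rw [degree_X_pow_sub_C (by norm_num)]; norm_num) hsp
  simp only [map_sub, map_pow, aeval_X, aeval_C, sub_eq_zero] at hα hβ
  have key : ∀ (x : L) (c : K), ¬ IsSquare c → x ^ 2 = algebraMap K L c → σ x = - x := by
    intro x c hc hx
    have h1 : (σ x) ^ 2 = x ^ 2 := by rw [← map_pow, hx, AlgEquiv.commutes]
    rcases sq_eq_sq_iff_eq_or_eq_neg.1 h1 with h | h
    · obtain ⟨y, hy⟩ := hfix x h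
      exact absurd ⟨y, (algebraMap K L).injective (by rw [← hx, ← hy, map_mul, sq])⟩ hc
    · exact h
  obtain ⟨y, hy⟩ := hfix (α * β) (by rw [map_mul, key α a ha hα, key β b hb hβ]; ring)
  exact ⟨y, (algebraMap K L).injective (by rw [map_mul, map_mul, ← hα, ← hβ, hy]; ring)⟩

theorem cube_class {K : Type} [Field K] (h3 : (3 : K) ≠ 0) (hcyc : IsCyclicField K) (z : K)
    (hz : z ^ 2 + z + 1 = 0) (a b : K)
    (ha : ¬ ∃ w, a = w ^ 3) (hb : ¬ ∃ w, b = w ^ 3) :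
    (∃ w, a * b = w ^ 3) ∨ (∃ w, a * b ^ 2 = w ^ 3) := by
  by_cases hab : a = b
  · right; exact ⟨a, by rw [hab]; ring⟩
  have ha0 : a ≠ 0 := fun h => ha ⟨0, by rw [h]; ring⟩
  have hb0 : b ≠ 0 := fun h => hb ⟨0, by rw [h]; ring⟩
  have hs : ((X ^ 3 - C a : K[X]) * (X ^ 3 - C b)).Separable := by
    refine Separable.mul (separable_X_pow_sub_C a (by exact_mod_cast h3) ha0)
      (separable_X_pow_sub_C b (by exact_mod_cast h3) hb0) ?_
    refine ⟨C (1 / (b - a)), - C (1 / (b - a)), ?_⟩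
    have : C (1 / (b - a)) * (C b - C a) = (1 : K[X]) := by
      rw [← C_sub, ← C_mul, one_div_mul_cancel (sub_ne_zero.2 (Ne.symm hab)), C_1]
    linear_combination this
  obtain ⟨L, _, _, σ, hsp, hfix⟩ := exists_gen hcyc _ hs
  obtain ⟨α, hα⟩ := exists_root_of_splits _ _ (Dvd.intro _ rfl) hs.ne_zero
    (by rw [degree_X_pow_sub_C (by norm_num)]; norm_num) hsp
  obtain ⟨β, hβ⟩ := exists_root_of_splits _ _ (Dvd.intro_left _ rfl) hs.ne_zero
    (by rw [degree_X_pow_sub_C (by norm_num)]; norm_num) hsp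
  simp only [map_sub, map_pow, aeval_X, aeval_C, sub_eq_zero] at hα hβ
  set ζ := algebraMap K L z with hζdef
  have hζ : ζ ^ 2 + ζ + 1 = 0 := by
    have := congrArg (algebraMap K L) hz
    simpa using this
  have hζ3 : ζ ^ 3 = 1 := by linear_combination (ζ - 1) * hζ
  have key : ∀ (x : L) (c : K), (¬ ∃ w, c = w ^ 3) → x ^ 3 = algebraMap K L c →
      σ x = ζ * x ∨ σ x = ζ ^ 2 * x := by
    intro x c hc hx
    have h1 : (σ x) ^ 3 = x ^ 3 := by rw [← map_pow, hx, AlgEquiv.commutes]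
    have h2 : (σ x - x) * ((σ x - ζ * x) * (σ x - ζ ^ 2 * x)) = 0 := by
      linear_combination h1 - (σ x) * x * (σ x - x) * hζ - x ^ 2 * (x - σ x) * hζ3
    rcases mul_eq_zero.1 h2 with h | h
    · obtain ⟨y, hy⟩ := hfix x (sub_eq_zero.1 h)
      exact absurd ⟨y, (algebraMap K L).injective (by rw [← hx, ← hy, map_pow])⟩ hc
    · rcases mul_eq_zero.1 h with h | h
      · exact Or.inl (sub_eq_zero.1 h)
      · exact Or.inr (sub_eq_zero.1 h)
  have fin1 : σ (α * β) = α * β → ∃ w, a * b = w ^ 3 := by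
    intro h
    obtain ⟨y, hy⟩ := hfix _ h
    exact ⟨y, (algebraMap K L).injective (by rw [map_mul, map_pow, ← hα, ← hβ, hy]; ring)⟩
  have fin2 : σ (α * β ^ 2) = α * β ^ 2 → ∃ w, a * b ^ 2 = w ^ 3 := by
    intro h
    obtain ⟨y, hy⟩ := hfix _ h
    exact ⟨y, (algebraMap K L).injective (by
      rw [map_mul, map_pow, map_pow, ← hα, ← hβ, hy]; ring)⟩
  rcases key α a ha hα with h | h <;> rcases key β b hb hβ with h' | h'
  · right; apply fin2; rw [map_mul, map_pow, h, h']; linear_combination α * β ^ 2 * hζ3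
  · left; apply fin1; rw [map_mul, h, h']; linear_combination α * β * hζ3
  · left; apply fin1; rw [map_mul, h, h']; linear_combination α * β * hζ3
  · right; apply fin2; rw [map_mul, map_pow, h, h']
    linear_combination α * β ^ 2 * (ζ ^ 3 + 1) * hζ3

/-- Artin-Schreier classes in characteristic three. -/
theorem as_class {K : Type} [Field K] (h3 : (3 : K) = 0) (hcyc : IsCyclicField K) (e : K)
    (he : e ≠ 0) (a b : K)
    (ha : ¬ ∃ w, a = w ^ 3 - e ^ 2 * w) (hb : ¬ ∃ w, b = w ^ 3 - e ^ 2 * w) :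
    (∃ w, a + b = w ^ 3 - e ^ 2 * w) ∨ (∃ w, a - b = w ^ 3 - e ^ 2 * w) := by
  by_cases hab : a = b
  · right; exact ⟨0, by rw [hab]; ring⟩
  have hsep : ∀ c : K, (X ^ 3 - C (e ^ 2) * X - C c : K[X]).Separable := by
    intro c
    refine ⟨0, - C (1 / e ^ 2), ?_⟩
    have h1 : C (1 / e ^ 2) * C (e ^ 2) = (1 : K[X]) := by
      rw [← C_mul, one_div_mul_cancel (pow_ne_zero _ he), C_1]
    simp only [derivative_sub, derivative_X_pow, derivative_C_mul, derivative_X, derivative_C]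
    have h33' : (C ((3 : ℕ) : K) : K[X]) = 0 := by
      rw [Nat.cast_ofNat, h3, C_0]
    rw [h33']
    linear_combination h1
  have hdeg : ∀ c : K, (X ^ 3 - C (e ^ 2) * X - C c : K[X]).degree ≠ 0 := by
    intro c
    have : (X ^ 3 - C (e ^ 2) * X - C c : K[X]).degree = 3 := by compute_degree!
    rw [this]; norm_num
  have hs : ((X ^ 3 - C (e ^ 2) * X - C a : K[X]) * (X ^ 3 - C (e ^ 2) * X - C b)).Separable := by
    refine Separable.mul (hsep a) (hsep b) ?_
    refine ⟨C (1 / (b - a)), - C (1 / (b - a)), ?_⟩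
    have : C (1 / (b - a)) * (C b - C a) = (1 : K[X]) := by
      rw [← C_sub, ← C_mul, one_div_mul_cancel (sub_ne_zero.2 (Ne.symm hab)), C_1]
    linear_combination this
  obtain ⟨L, _, _, σ, hsp, hfix⟩ := exists_gen hcyc _ hs
  obtain ⟨α, hα⟩ := exists_root_of_splits _ _ (Dvd.intro _ rfl) hs.ne_zero (hdeg a) hsp
  obtain ⟨β, hβ⟩ := exists_root_of_splits _ _ (Dvd.intro_left _ rfl) hs.ne_zero (hdeg b) hsp
  simp only [map_sub, map_mul, map_pow, aeval_X, aeval_C] at hα hβ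
  set ε := algebraMap K L e with hε
  have h3L : (3 : L) = 0 := by
    have := congrArg (algebraMap K L) h3
    rwa [map_ofNat, map_zero] at this
  have key : ∀ (x : L) (c : K), (¬ ∃ w, c = w ^ 3 - e ^ 2 * w) →
      x ^ 3 - ε ^ 2 * x - algebraMap K L c = 0 → σ x = x + ε ∨ σ x = x - ε := by
    intro x c hc hx
    have h1 : (σ x) ^ 3 - ε ^ 2 * (σ x) - algebraMap K L c = 0 := by
      have := congrArg σ hx
      simpa [hε] using this
    have h2 : (σ x - x) * ((σ x - x - ε) * (σ x - x + ε)) = 0 := by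
      linear_combination h1 - hx + (-(σ x) ^ 2 * x + (σ x) * x ^ 2) * h3L
    rcases mul_eq_zero.1 h2 with h | h
    · obtain ⟨y, hy⟩ := hfix x (sub_eq_zero.1 h)
      refine absurd ⟨y, (algebraMap K L).injective ?_⟩ hc
      rw [← hy] at hx
      simp only [map_sub, map_mul, map_pow]
      linear_combination -hx
    · rcases mul_eq_zero.1 h with h | h
      · exact Or.inl (by linear_combination h)
      · exact Or.inr (by linear_combination h)
  have fin1 : σ (α + β) = α + β → ∃ w, a + b = w ^ 3 - e ^ 2 * w := by
    intro h
    obtain ⟨y, hy⟩ := hfix _ h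
    refine ⟨y, (algebraMap K L).injective ?_⟩
    simp only [map_sub, map_add, map_mul, map_pow, hy]
    linear_combination - hα - hβ - (α ^ 2 * β + α * β ^ 2) * h3L
  have fin2 : σ (α - β) = α - β → ∃ w, a - b = w ^ 3 - e ^ 2 * w := by
    intro h
    obtain ⟨y, hy⟩ := hfix _ h
    refine ⟨y, (algebraMap K L).injective ?_⟩
    simp only [map_sub, map_add, map_mul, map_pow, hy]
    linear_combination - hα + hβ - (-α ^ 2 * β + α * β ^ 2) * h3L
  rcases key α a ha hα with h | h <;> rcases key β b hb hβ with h' | h'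
  · right; apply fin2; rw [map_sub, h, h']; ring
  · left; apply fin1; rw [map_add, h, h']; ring
  · left; apply fin1; rw [map_add, h, h']; ring
  · right; apply fin2; rw [map_sub, h, h']; ring

/-- An irreducible separable cubic over a cyclic field has square discriminant. -/
theorem disc_square {K : Type} [Field K] (hcyc : IsCyclicField K) (A B D : K)
    (hdisc : A ^ 2 * B ^ 2 - 4 * B ^ 3 - 4 * A ^ 3 * D - 27 * D ^ 2 + 18 * A * B * D ≠ 0)
    (hroot : ∀ x : K, x ^ 3 + A * x ^ 2 + B * x + D ≠ 0) :
    IsSquare (A ^ 2 * B ^ 2 - 4 * B ^ 3 - 4 * A ^ 3 * D - 27 * D ^ 2 + 18 * A * B * D) := by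
  set δ := A ^ 2 * B ^ 2 - 4 * B ^ 3 - 4 * A ^ 3 * D - 27 * D ^ 2 + 18 * A * B * D with hδ
  have hs : (X ^ 3 + C A * X ^ 2 + C B * X + C D : K[X]).Separable := by
    refine ⟨C (1 / δ) * (3 * C (6 * B - 2 * A ^ 2) * X + C (15 * A * B - 4 * A ^ 3 - 27 * D)),
      - (C (1 / δ) * (C (6 * B - 2 * A ^ 2) * X ^ 2 + C (7 * A * B - 2 * A ^ 3 - 9 * D) * X
        + C (4 * B ^ 2 - A ^ 2 * B - 3 * A * D))), ?_⟩
    have h1 : C (1 / δ) * C δ = (1 : K[X]) := by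
      rw [← C_mul, one_div_mul_cancel hdisc, C_1]
    rw [← h1, hδ]
    simp only [derivative_add, derivative_X_pow, derivative_C_mul, derivative_X, derivative_C,
      C_add, C_sub, C_mul, C_pow, Nat.cast_ofNat, map_ofNat]
    ring
  have hdeg : (X ^ 3 + C A * X ^ 2 + C B * X + C D : K[X]).degree ≠ 0 := by
    have : (X ^ 3 + C A * X ^ 2 + C B * X + C D : K[X]).degree = 3 := by compute_degree!
    rw [this]; norm_num
  obtain ⟨L, _, _, σ, hsp, hfix⟩ := exists_gen hcyc _ hs
  obtain ⟨α, hα⟩ := exists_root_of_splits _ _ dvd_rfl hs.ne_zero hdeg hsp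
  simp only [map_add, map_mul, map_pow, aeval_X, aeval_C] at hα
  set A' := algebraMap K L A with hA
  set B' := algebraMap K L B with hB
  set D' := algebraMap K L D with hD
  have hσA : σ A' = A' := σ.commutes A
  have hσB : σ B' = B' := σ.commutes B
  have hσD : σ D' = D' := σ.commutes D
  have hnoroot : ∀ x : L, σ x = x → x ^ 3 + A' * x ^ 2 + B' * x + D' ≠ 0 := by
    intro x hx h
    obtain ⟨y, rfl⟩ := hfix x hx
    exact hroot y ((algebraMap K L).injective (by simpa using h))
  have step : ∀ x : L, x ^ 3 + A' * x ^ 2 + B' * x + D' = 0 →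
      (σ x) ^ 3 + A' * (σ x) ^ 2 + B' * (σ x) + D' = 0 := by
    intro x hx
    have := congrArg σ hx
    simpa [hσA, hσB, hσD] using this
  set β := σ α with hβdef
  set γ := σ β with hγdef
  have hβ := step α hα
  have hγ := step β hβ
  rw [← hβdef] at hβ
  rw [← hγdef] at hγ
  have hαβ : α ≠ β := fun h => hnoroot α h.symm hα
  have hβγ : β ≠ γ := fun h => hαβ (σ.injective h)
  have e1 : α ^ 2 + α * β + β ^ 2 + A' * (α + β) + B' = 0 := by
    apply mul_left_cancel₀ (sub_ne_zero.2 hαβ)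
    linear_combination hα - hβ
  have e2 : β ^ 2 + β * γ + γ ^ 2 + A' * (β + γ) + B' = 0 := by
    apply mul_left_cancel₀ (sub_ne_zero.2 hβγ)
    linear_combination hβ - hγ
  have hαγ : α ≠ γ := by
    intro h
    refine hnoroot (-A' - α - β) ?_ ?_
    · rw [map_sub, map_sub, map_neg, hσA, ← hβdef, ← hγdef, ← h]; ring
    · linear_combination hα + (-A' - 2 * α - β) * e1
  have e3 : α + β + γ + A' = 0 := by
    apply mul_left_cancel₀ (sub_ne_zero.2 hαγ)
    linear_combination e1 - e2
  have hσγ : σ γ = α := by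
    have := congrArg σ e3
    simp only [map_add, ← hβdef, ← hγdef, hσA, map_zero] at this
    linear_combination this - e3
  obtain ⟨y, hy⟩ := hfix ((α - β) * (β - γ) * (γ - α)) (by
    simp only [map_mul, map_sub, ← hβdef, ← hγdef, hσγ]; ring)
  refine ⟨y, (algebraMap K L).injective ?_⟩
  have hA2 : A' = - (α + β + γ) := by linear_combination e3
  have hB2 : B' = α * β + β * γ + γ * α := by rw [hA2] at e1; linear_combination e1
  have hD2 : D' = - (α * β * γ) := by rw [hA2, hB2] at hα; linear_combination hα
  rw [map_mul, hy, hδ]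
  simp only [map_add, map_sub, map_mul, map_pow, ← hA, ← hB, ← hD, hA2, hB2, hD2, map_ofNat]
  ring

theorem ev_quad {K : Type} [Field K] (n : ℕ) (hn : n ≠ 0) (α β γ : K)
    (h : α ≠ 0 ∨ β ≠ 0 ∨ γ ≠ 0) :
    ∀ᶠ t in (cofinite : Filter K), α * (t ^ n) ^ 2 + β * t ^ n + γ ≠ 0 := by
  set p : K[X] := C α * (X ^ n) ^ 2 + C β * X ^ n + C γ with hp
  have hp0 : p ≠ 0 := by
    intro h0
    have c0 : p.coeff 0 = γ := by
      simp [hp, ← pow_mul, coeff_X_pow, hn, Ne.symm hn]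
    have c1 : p.coeff n = β := by
      have : n ≠ n * 2 := by omega
      simp [hp, ← pow_mul, coeff_X_pow, coeff_C, hn, this]
    have c2 : p.coeff (n * 2) = α := by
      have : n * 2 ≠ n := by omega
      simp [hp, ← pow_mul, coeff_X_pow, coeff_C, hn, this]
    rw [h0] at c0 c1 c2
    simp only [coeff_zero] at c0 c1 c2
    rcases h with h | h | h
    · exact h c2.symm
    · exact h c1.symm
    · exact h c0.symm
  have hf : {t : K | p.IsRoot t}.Finite := finite_setOfPred_isRoot hp0
  have := hf.eventually_cofinite_notMem
  filter_upwards [this] with t ht h0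
  apply ht
  show p.eval t = 0
  rw [← h0]
  simp [hp]

theorem ev_ne_zero {K : Type} [Field K] : ∀ᶠ t in (cofinite : Filter K), t ≠ 0 := by
  have := (Set.finite_singleton (0 : K)).eventually_cofinite_notMem
  simpa using this

/-- A class function with values in `ZMod n`. -/
structure IsClassFn {K : Type} [Field K] (n : ℕ) (κ : K → ZMod n) : Prop where
  mul : ∀ x y : K, x ≠ 0 → y ≠ 0 → κ (x * y) = κ x + κ y
  zero_iff : ∀ x : K, x ≠ 0 → (κ x = 0 ↔ ∃ w, x = w ^ n)

theorem exists_classFn {K : Type} [Field K] (n : ℕ) (hn : n ≠ 0) (c : K) (hc0 : c ≠ 0)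
    (hgen : ∀ x : K, x ≠ 0 → ∃ (k : ℕ) (w : K), x = c ^ k * w ^ n)
    (hord : ∀ (k : ℕ) (w : K), c ^ k = w ^ n → n ∣ k) :
    ∃ κ : K → ZMod n, IsClassFn n κ ∧ κ c = 1 := by
  have hgen' : ∀ x : K, ∃ (k : ℕ), x ≠ 0 → ∃ w : K, w ≠ 0 ∧ x = c ^ k * w ^ n := by
    intro x
    by_cases hx : x = 0
    · exact ⟨0, fun h => absurd hx h⟩
    · obtain ⟨k, w, h⟩ := hgen x hx
      refine ⟨k, fun _ => ⟨w, ?_, h⟩⟩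
      rintro rfl
      apply hx
      rw [h, zero_pow hn, mul_zero]
  choose k hk using hgen'
  have uniq1 : ∀ (i j : ℕ) (v w : K), i ≤ j → v ≠ 0 → w ≠ 0 → c ^ i * v ^ n = c ^ j * w ^ n →
      (i : ZMod n) = j := by
    intro i j v w hij hv hw h
    obtain ⟨d, rfl⟩ := Nat.exists_eq_add_of_le hij
    have : c ^ d = (v / w) ^ n := by
      rw [div_pow, eq_div_iff (pow_ne_zero _ hw)]
      apply mul_left_cancel₀ (pow_ne_zero i hc0)
      rw [h]; ring
    have := hord _ _ this
    rw [← CharP.cast_eq_zero_iff (ZMod n)] at this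
    rw [Nat.cast_add, this, add_zero]
  have uniq : ∀ (i j : ℕ) (v w : K), v ≠ 0 → w ≠ 0 → c ^ i * v ^ n = c ^ j * w ^ n →
      (i : ZMod n) = j := by
    intro i j v w hv hw h
    rcases le_total i j with hij | hij
    · exact uniq1 i j v w hij hv hw h
    · exact (uniq1 j i w v hij hw hv h.symm).symm
  refine ⟨fun x => (k x : ZMod n), ⟨?_, ?_⟩, ?_⟩
  · intro x y hx hy
    obtain ⟨u, hu, e1⟩ := hk x hx
    obtain ⟨v, hv, e2⟩ := hk y hy
    obtain ⟨w, hw, e3⟩ := hk (x * y) (mul_ne_zero hx hy)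
    have := uniq (k (x * y)) (k x + k y) w (u * v) hw (mul_ne_zero hu hv) (by
      rw [← e3]; nth_rewrite 1 [e1]; nth_rewrite 1 [e2]; ring)
    simpa using this
  · intro x hx
    obtain ⟨u, hu, e1⟩ := hk x hx
    constructor
    · intro h
      obtain ⟨m, hm⟩ := (CharP.cast_eq_zero_iff (ZMod n) n (k x)).1 h
      refine ⟨c ^ m * u, ?_⟩
      rw [hm] at e1
      rw [e1]; ring
    · rintro ⟨w, hw⟩
      have hw0 : w ≠ 0 := by
        rintro rfl
        exact hx (by rw [hw, zero_pow hn])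
      have := uniq (k x) 0 u w hu hw0 (by rw [← e1, hw]; ring)
      simpa using this
  · obtain ⟨u, hu, e1⟩ := hk c hc0
    have := uniq (k c) 1 u 1 hu one_ne_zero (by rw [← e1]; ring)
    simpa using this

theorem IsClassFn.pow {K : Type} [Field K] {n : ℕ} {κ : K → ZMod n} (h : IsClassFn n κ)
    (x : K) (hx : x ≠ 0) (m : ℕ) : κ (x ^ m) = m * κ x := by
  induction m with
  | zero =>
    rw [pow_zero, (h.zero_iff 1 one_ne_zero).2 ⟨1, by ring⟩]; simp
  | succ m ih =>
    rw [pow_succ, h.mul _ _ (pow_ne_zero _ hx) hx, ih]; push_cast; ring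

/-- The generic configuration lemma. -/
theorem generic_pair {K : Type} [Field K] [Infinite K] (N n : ℕ) (hn : n ≠ 0)
    (hNn : N ∣ 2 * n) (κ : K → ZMod N) (hκ : IsClassFn N κ) (hN : N ≠ 0) (b : K)
    (hZ : {x : K | ∃ w, x ^ 2 + b = w ^ N}.Finite) (y : K) (hy : ¬ ∃ w, y ^ 2 + b = w ^ N)
    (S : Finset K) :
    ∃ s : K, (∀ α ∈ S, ¬ ∃ w, (y + α * s ^ n) ^ 2 + b = w ^ N) ∧
      (∀ α ∈ S, κ ((y + α * s ^ n) ^ 2 + b) ≠ 0) ∧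
      (∀ α ∈ S, ∀ β ∈ S, α ≠ β →
        κ ((y + α * s ^ n) ^ 2 + b) + κ ((y + β * s ^ n) ^ 2 + b) ≠ 2 * κ (α - β)) := by
  set Z := {x : K | ∃ w, x ^ 2 + b = w ^ N} with hZdef
  have hg0 : y ^ 2 + b ≠ 0 := fun h => hy ⟨0, by rw [h, zero_pow hN]⟩
  have E1 : ∀ᶠ s in (cofinite : Filter K), ∀ α ∈ S, ∀ z ∈ Z, y + α * s ^ n ≠ z := by
    rw [Filter.eventually_all_finset]
    intro α _
    rw [Filter.eventually_all_finite hZ]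
    intro z hz
    have hyz : y - z ≠ 0 := by
      intro h
      rw [sub_eq_zero] at h
      exact hy (h ▸ hz)
    filter_upwards [ev_quad n hn 0 α (y - z) (Or.inr (Or.inr hyz))] with s hs h
    apply hs
    linear_combination h
  have E2 : ∀ᶠ s in (cofinite : Filter K), ∀ α ∈ S, ∀ β ∈ S, ∀ z ∈ Z,
      (α * β) * (s ^ n) ^ 2 + (y * (α + β) - z * (α - β)) * s ^ n + (y ^ 2 + b) ≠ 0 := by
    rw [Filter.eventually_all_finset]
    intro α _
    rw [Filter.eventually_all_finset]
    intro β _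
    rw [Filter.eventually_all_finite hZ]
    intro z hz
    exact ev_quad n hn _ _ _ (Or.inr (Or.inr hg0))
  obtain ⟨s, hs1, hs2, hs0⟩ := (E1.and (E2.and ev_ne_zero)).exists
  have hnZ : ∀ α ∈ S, ¬ ∃ w, (y + α * s ^ n) ^ 2 + b = w ^ N := by
    intro α hα h
    exact hs1 α hα _ h rfl
  have hne : ∀ α ∈ S, (y + α * s ^ n) ^ 2 + b ≠ 0 := by
    intro α hα h
    exact hnZ α hα ⟨0, by rw [h, zero_pow hN]⟩
  refine ⟨s, hnZ, ?_, ?_⟩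
  · intro α hα h
    exact hnZ α hα ((hκ.zero_iff _ (hne α hα)).1 h)
  · intro α hα β hβ hαβ h
    have hd : (α - β) * s ^ n ≠ 0 := mul_ne_zero (sub_ne_zero.2 hαβ) (pow_ne_zero _ hs0)
    set v := y + α * s ^ n with hv
    set w := y + β * s ^ n with hw
    set m := (v * w + b) / ((α - β) * s ^ n) with hm
    have hmd : m * ((α - β) * s ^ n) = v * w + b := div_mul_cancel₀ _ hd
    have hmZ : m ∉ Z := by
      intro hmZ
      apply hs2 α hα β hβ m hmZ
      rw [hv, hw] at hmd
      linear_combination -hmd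
    have hgm : (m ^ 2 + b) * ((α - β) * s ^ n) ^ 2 = (v ^ 2 + b) * (w ^ 2 + b) := by
      have hvw : v - w = (α - β) * s ^ n := by rw [hv, hw]; ring
      have : (m ^ 2 + b) * ((α - β) * s ^ n) ^ 2
        = (m * ((α - β) * s ^ n)) ^ 2 + b * ((α - β) * s ^ n) ^ 2 := by ring
      rw [this, hmd, ← hvw]; ring
    have hgm0 : m ^ 2 + b ≠ 0 := fun h => hmZ ⟨0, by rw [h, zero_pow hN]⟩
    have hk := congrArg κ hgm
    rw [hκ.mul _ _ hgm0 (pow_ne_zero _ hd), hκ.mul _ _ (hne α hα) (hne β hβ), hκ.pow _ hd,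
      hκ.mul _ _ (sub_ne_zero.2 hαβ) (pow_ne_zero _ hs0), hκ.pow _ hs0, h] at hk
    have h2n : ((2 : ℕ) : ZMod N) * ((n : ZMod N) * κ s) = 0 := by
      have := (CharP.cast_eq_zero_iff (ZMod N) N (2 * n)).2 hNn
      rw [← mul_assoc, ← Nat.cast_mul, this, zero_mul]
    have h0 : κ (m ^ 2 + b) = 0 := by
      push_cast at hk h2n
      linear_combination hk - h2n
    exact hmZ ((hκ.zero_iff _ hgm0).1 h0)

/-- Curves `x ^ 3 = y ^ 2 + b`. -/
theorem caseA {K : Type} [Field K] [Infinite K] (h2 : (2 : K) ≠ 0) (h3 : (3 : K) ≠ 0)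
    (κ : K → ZMod 3) (hκ : IsClassFn 3 κ) (c : K) (hc0 : c ≠ 0) (hc : κ c = 1) (b : K) :
    {x : K | ∃ w, x ^ 2 + b = w ^ 3}.Infinite := by
  intro hZ
  obtain ⟨y, hy⟩ : ∃ y : K, y ∉ {x : K | ∃ w, x ^ 2 + b = w ^ 3} := hZ.exists_notMem
  have hcube : ∀ t : K, t ≠ 0 → κ (t ^ 3) = 0 := fun t ht =>
    (hκ.zero_iff _ (pow_ne_zero _ ht)).2 ⟨t, rfl⟩
  have h6 : (6 : K) ≠ 0 := by
    have : (6 : K) = 2 * 3 := by norm_num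
    rw [this]; exact mul_ne_zero h2 h3
  let p : K → ℕ → K := fun d i => match i with
    | 0 => 0
    | 1 => -(d / 6 + 1) ^ 3
    | 2 => -(d / 6 + 1) ^ 3 - (d / 6 - 1) ^ 3
    | 3 => -(d / 6 + 1) ^ 3 - (d / 6 - 1) ^ 3 + (d / 6) ^ 3
    | _ => -(d / 6 + 1) ^ 3 - (d / 6 - 1) ^ 3 + (d / 6) ^ 3 + (d / 6) ^ 3
  have hp4 : ∀ d, p d 4 = - d := by
    intro d
    show -(d / 6 + 1) ^ 3 - (d / 6 - 1) ^ 3 + (d / 6) ^ 3 + (d / 6) ^ 3 = - d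
    field_simp; ring
  classical
  obtain ⟨s, -, hs1, hs2⟩ := generic_pair 3 3 (by norm_num) (by norm_num) κ hκ (by norm_num) b
    hZ y hy ((Finset.range 5).image (p c) ∪ (Finset.range 5).image (p (c ^ 2)))
  set S := (Finset.range 5).image (p c) ∪ (Finset.range 5).image (p (c ^ 2)) with hS
  set k : K → ZMod 3 := fun α => κ ((y + α * s ^ 3) ^ 2 + b) with hk
  have edge : ∀ α ∈ S, ∀ β ∈ S, ∀ t : K, α - β = t ^ 3 → k α = k β := by
    intro α hα β hβ t ht
    by_cases h : α = β
    · rw [h]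
    have ht0 : t ≠ 0 := by
      rintro rfl
      apply h
      linear_combination ht
    have e := hs2 α hα β hβ h
    rw [ht, hcube t ht0] at e
    have e1 := hs1 α hα
    have e2 := hs1 β hβ
    change k α ≠ 0 at e1
    change k β ≠ 0 at e2
    change k α + k β ≠ 2 * 0 at e
    revert e e1 e2
    generalize k α = u
    generalize k β = v
    revert u v
    decide
  have chain : ∀ d : K, (∀ i < 5, p d i ∈ S) → k (p d 0) = k (p d 4) := by
    intro d hd
    rw [edge _ (hd 0 (by norm_num)) _ (hd 1 (by norm_num)) (d / 6 + 1) (by simp only [p]; ring),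
      edge _ (hd 1 (by norm_num)) _ (hd 2 (by norm_num)) (d / 6 - 1) (by simp only [p]; ring),
      edge _ (hd 2 (by norm_num)) _ (hd 3 (by norm_num)) (-(d / 6)) (by simp only [p]; ring),
      edge _ (hd 3 (by norm_num)) _ (hd 4 (by norm_num)) (-(d / 6)) (by simp only [p]; ring)]
  have m1 : ∀ i < 5, p c i ∈ S := fun i hi =>
    Finset.mem_union_left _ (Finset.mem_image_of_mem _ (Finset.mem_range.2 hi))
  have m2 : ∀ i < 5, p (c ^ 2) i ∈ S := fun i hi =>
    Finset.mem_union_right _ (Finset.mem_image_of_mem _ (Finset.mem_range.2 hi))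
  have hc2 : c ^ 2 ≠ 0 := pow_ne_zero _ hc0
  have c1 := chain c m1
  have c2 := chain (c ^ 2) m2
  have z1 : p c 0 - p c 4 = c := by rw [hp4]; simp only [p]; ring
  have z2 : p (c ^ 2) 0 - p (c ^ 2) 4 = c ^ 2 := by rw [hp4]; simp only [p]; ring
  have f1 := hs2 _ (m1 0 (by norm_num)) _ (m1 4 (by norm_num))
    (by intro h; rw [h, sub_self] at z1; exact hc0 z1.symm)
  have f2 := hs2 _ (m2 0 (by norm_num)) _ (m2 4 (by norm_num))
    (by intro h; rw [h, sub_self] at z2; exact hc2 z2.symm)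
  rw [z1, hc] at f1
  rw [z2, hκ.pow _ hc0, hc] at f2
  change k (p c 0) + k (p c 4) ≠ _ at f1
  change k (p (c ^ 2) 0) + k (p (c ^ 2) 4) ≠ _ at f2
  rw [← c1] at f1
  rw [← c2] at f2
  have hk0 : k (p c 0) ≠ 0 := hs1 _ (m1 0 (by norm_num))
  have : p (c ^ 2) 0 = p c 0 := rfl
  rw [this] at f2
  revert f1 f2 hk0
  generalize k (p c 0) = u
  revert u
  decide

theorem finite_pow_eq_one {K : Type} [Field K] (n : ℕ) (hn : 0 < n) :
    {ρ : K | ρ ^ n = 1}.Finite := by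
  have hp : (X ^ n - C 1 : K[X]) ≠ 0 := X_pow_sub_C_ne_zero hn 1
  refine (finite_setOfPred_isRoot hp).subset ?_
  intro ρ hρ
  show (X ^ n - C 1 : K[X]).eval ρ = 0
  rw [eval_sub, eval_pow, eval_X, eval_C, sub_eq_zero]
  exact hρ

theorem caseB {K : Type} [Field K] [Infinite K] (h2 : (2 : K) ≠ 0) (hm1 : IsSquare (-1 : K))
    (c : K) (hc : ¬ IsSquare c)
    (hsq : ∀ a b : K, ¬ IsSquare a → ¬ IsSquare b → IsSquare (a * b)) (b : K) :
    {x : K | ∃ w, x ^ 2 + b = w ^ 4}.Infinite := by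
  intro hZ
  have hc0 : c ≠ 0 := fun h => hc (h ▸ IsSquare.zero)
  obtain ⟨ι, hι⟩ := hm1
  have half : ∀ x : K, ∃ (k : ℕ) (w : K), x = c ^ k * w ^ 2 := by
    intro x
    by_cases hx : IsSquare x
    · obtain ⟨w, hw⟩ := hx
      exact ⟨0, w, by rw [hw]; ring⟩
    · obtain ⟨w, hw⟩ := hsq c x hc hx
      refine ⟨1, w / c, ?_⟩
      field_simp
      linear_combination hw
  have hpar : ∀ (k : ℕ), IsSquare (c ^ k) → 2 ∣ k := by
    intro k hk
    by_contra hodd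
    obtain ⟨m, rfl⟩ : ∃ m, k = 2 * m + 1 := ⟨k / 2, by omega⟩
    obtain ⟨w, hw⟩ := hk
    apply hc
    refine ⟨w / c ^ m, ?_⟩
    have := pow_ne_zero m hc0
    field_simp
    linear_combination hw
  have hpm : ∀ u w : K, u ^ 2 = w ^ 4 → IsSquare u := by
    intro u w h
    have : u ^ 2 = (w ^ 2) ^ 2 := by rw [h]; ring
    rcases sq_eq_sq_iff_eq_or_eq_neg.1 this with h | h
    · exact ⟨w, by rw [h]; ring⟩
    · exact ⟨ι * w, by rw [h]; linear_combination (w ^ 2) * hι⟩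
  obtain ⟨κ, hκ, -⟩ := exists_classFn 4 (by norm_num) c hc0 (by
    intro x _
    obtain ⟨k, w, h⟩ := half x
    obtain ⟨l, v, h'⟩ := half w
    exact ⟨k + 2 * l, v, by rw [h, h']; ring⟩) (by
    intro k w h
    obtain ⟨m, rfl⟩ := hpar k ⟨w ^ 2, by rw [h]; ring⟩
    obtain ⟨l, rfl⟩ := hpar m (hpm (c ^ m) w (by rw [← h]; ring))
    exact ⟨l, by ring⟩)
  have k0 : ∀ x : K, x ≠ 0 → IsSquare x → 2 * κ x = 0 := by
    rintro x hx ⟨v, hv⟩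
    have := hκ.pow x hx 2
    push_cast at this
    rw [← this]
    exact (hκ.zero_iff _ (pow_ne_zero _ hx)).2 ⟨v, by rw [hv]; ring⟩
  have k2 : ∀ x : K, ¬ IsSquare x → 2 * κ x = 2 := by
    intro x hx
    have hx0 : x ≠ 0 := fun h => hx (h ▸ IsSquare.zero)
    have h1 : 2 * κ x ≠ 0 := by
      intro h
      have := hκ.pow x hx0 2
      push_cast at this
      rw [h] at this
      obtain ⟨w, hw⟩ := (hκ.zero_iff _ (pow_ne_zero _ hx0)).1 this
      exact hx (hpm x w hw)
    revert h1
    generalize κ x = u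
    revert u
    decide
  have hmulsq : ∀ x v : K, ¬ IsSquare x → v ≠ 0 → ¬ IsSquare (x * v ^ 2) := by
    rintro x v hx hv ⟨w, hw⟩
    apply hx
    refine ⟨w / v, ?_⟩
    field_simp
    linear_combination hw
  classical
  -- step one: a point of class two
  obtain ⟨y0, hy0⟩ : ∃ y : K, y ∉ {x : K | ∃ w, x ^ 2 + b = w ^ 4} := hZ.exists_notMem
  obtain ⟨y, hy, hyk⟩ : ∃ y, (¬ ∃ w, y ^ 2 + b = w ^ 4) ∧ κ (y ^ 2 + b) = 2 := by
    obtain ⟨τ, hτ0, hτ1, hτ2⟩ := ((ev_ne_zero (K := K)).and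
      ((ev_quad 2 two_ne_zero (0 : K) 1 (-1) (by simp)).and
      (ev_quad 2 two_ne_zero (0 : K) 1 1 (by simp)))).exists
    have hτ1' : 1 - τ ^ 2 ≠ 0 := fun h => hτ1 (by linear_combination -h)
    have hτ2' : 1 + τ ^ 2 ≠ 0 := fun h => hτ2 (by linear_combination h)
    set r := (1 + τ ^ 2) / (1 - τ ^ 2) with hr
    have hr0 : r ≠ 0 := div_ne_zero hτ2' hτ1'
    have hr1 : r ^ 2 - 1 = (2 * τ / (1 - τ ^ 2)) ^ 2 := by
      rw [hr]; field_simp; ring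
    have hq0 : 2 * τ / (1 - τ ^ 2) ≠ 0 := div_ne_zero (mul_ne_zero h2 hτ0) hτ1'
    obtain ⟨s, hs0, hs1, hs2⟩ := generic_pair 4 2 (by norm_num) (by norm_num) κ hκ (by norm_num)
      b hZ y0 hy0 {0, c, c * r ^ 2}
    have n1 : ¬ IsSquare (c - 0) := by rwa [sub_zero]
    have n2 : ¬ IsSquare (c * r ^ 2 - 0) := by rw [sub_zero]; exact hmulsq c r hc hr0
    have n3 : ¬ IsSquare (c * r ^ 2 - c) := by
      have : c * r ^ 2 - c = c * (2 * τ / (1 - τ ^ 2)) ^ 2 := by rw [← hr1]; ring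
      rw [this]
      exact hmulsq _ _ hc hq0
    have ne : ∀ u v : K, ¬ IsSquare (u - v) → u ≠ v := by
      rintro u v h rfl
      exact h (by rw [sub_self]; exact IsSquare.zero)
    have m1 : (0 : K) ∈ ({0, c, c * r ^ 2} : Finset K) := by simp
    have m2 : c ∈ ({0, c, c * r ^ 2} : Finset K) := by simp
    have m3 : c * r ^ 2 ∈ ({0, c, c * r ^ 2} : Finset K) := by simp
    have e1 := hs2 _ m2 _ m1 (ne _ _ n1)
    have e2 := hs2 _ m3 _ m1 (ne _ _ n2)
    have e3 := hs2 _ m3 _ m2 (ne _ _ n3)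
    rw [k2 _ n1] at e1
    rw [k2 _ n2] at e2
    rw [k2 _ n3] at e3
    have a1 := hs1 _ m1
    have a2 := hs1 _ m2
    have a3 := hs1 _ m3
    have : κ ((y0 + 0 * s ^ 2) ^ 2 + b) = 2 ∨ κ ((y0 + c * s ^ 2) ^ 2 + b) = 2 ∨
        κ ((y0 + c * r ^ 2 * s ^ 2) ^ 2 + b) = 2 := by
      revert e1 e2 e3 a1 a2 a3
      generalize κ ((y0 + 0 * s ^ 2) ^ 2 + b) = u
      generalize κ ((y0 + c * s ^ 2) ^ 2 + b) = v
      generalize κ ((y0 + c * r ^ 2 * s ^ 2) ^ 2 + b) = w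
      revert u v w
      decide
    rcases this with h | h | h
    · exact ⟨_, hs0 _ m1, h⟩
    · exact ⟨_, hs0 _ m2, h⟩
    · exact ⟨_, hs0 _ m3, h⟩
  -- step two
  obtain ⟨r, hr120, hr1⟩ : ∃ r : K, r ^ 120 ≠ 1 ∧ ¬ IsSquare (r ^ 2 - 1) := by
    have hfin : {ρ : K | ρ ^ 120 = 1}.Finite := by
      exact finite_pow_eq_one 120 (by norm_num)
    have E : ∀ᶠ τ in (cofinite : Filter K), ∀ ρ ∈ {ρ : K | ρ ^ 120 = 1},
        0 * (τ ^ 2) ^ 2 + (c * (1 + ρ)) * τ ^ 2 + (1 - ρ) ≠ 0 := by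
      rw [Filter.eventually_all_finite hfin]
      intro ρ _
      apply ev_quad 2 two_ne_zero
      right
      by_cases h : ρ = 1
      · left
        rw [h]
        exact mul_ne_zero hc0 (by norm_num [h2])
      · right
        exact sub_ne_zero.2 (Ne.symm h)
    obtain ⟨τ, hτ, hτ0⟩ := (E.and ev_ne_zero).exists
    have hd : 1 - c * τ ^ 2 ≠ 0 := by
      intro h
      apply hc
      refine ⟨1 / τ, ?_⟩
      field_simp
      linear_combination -h
    refine ⟨(1 + c * τ ^ 2) / (1 - c * τ ^ 2), ?_, ?_⟩
    · intro h
      apply hτ _ h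
      have hρ := div_mul_cancel₀ (1 + c * τ ^ 2) hd
      linear_combination - hρ
    · have : ((1 + c * τ ^ 2) / (1 - c * τ ^ 2)) ^ 2 - 1 = c * (2 * τ / (1 - c * τ ^ 2)) ^ 2 := by
        field_simp; ring
      rw [this]
      exact hmulsq _ _ hc (div_ne_zero (mul_ne_zero h2 hτ0) hd)
  have hr0 : r ≠ 0 := by
    rintro rfl
    apply hr1
    exact ⟨ι, by rw [← hι]; ring⟩
  have hrk : ∀ m : ℕ, 1 ≤ m → m ≤ 5 → r ^ (2 * m) - 1 ≠ 0 := by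
    intro m h1 h5 h
    apply hr120
    have hh : r ^ (2 * m) = 1 := by linear_combination h
    obtain ⟨q, hq⟩ : 2 * m ∣ 120 := by interval_cases m <;> norm_num
    rw [hq, pow_mul, hh, one_pow]
  obtain ⟨s, -, hs1, hs2⟩ := generic_pair 4 2 (by norm_num) (by norm_num) κ hκ (by norm_num)
    b hZ y hy (({0} ∪ (Finset.range 6).image (fun j => r ^ (2 * j))) ∪
      (Finset.range 6).image (fun j => c * r ^ (2 * j)))
  set S := (({0} ∪ (Finset.range 6).image (fun j => r ^ (2 * j))) ∪
      (Finset.range 6).image (fun j => c * r ^ (2 * j))) with hS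
  set k : K → ZMod 4 := fun α => κ ((y + α * s ^ 2) ^ 2 + b) with hk
  have hk0 : k 0 = 2 := by simp only [hk]; rw [zero_mul, add_zero, hyk]
  have m0 : (0 : K) ∈ S := by simp [hS]
  have mr : ∀ j < 6, r ^ (2 * j) ∈ S := by
    intro j hj
    exact Finset.mem_union_left _ (Finset.mem_union_right _
      (Finset.mem_image.2 ⟨j, Finset.mem_range.2 hj, rfl⟩))
  have mc : ∀ j < 6, c * r ^ (2 * j) ∈ S := by
    intro j hj
    exact Finset.mem_union_right _ (Finset.mem_image.2 ⟨j, Finset.mem_range.2 hj, rfl⟩)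
  have hsplit : ∀ i m : ℕ, r ^ (2 * (i + m)) - r ^ (2 * i) = (r ^ (2 * m) - 1) * (r ^ i) ^ 2 := by
    intro i m; ring
  have kr : ∀ j < 6, k (r ^ (2 * j)) = 1 ∨ k (r ^ (2 * j)) = 3 := by
    intro j hj
    have h1 := hs1 _ (mr j hj)
    have h3 := hs2 _ (mr j hj) _ m0 (pow_ne_zero _ hr0)
    rw [sub_zero, k0 _ (pow_ne_zero _ hr0) ⟨r ^ j, by ring⟩] at h3
    change k (r ^ (2 * j)) ≠ 0 at h1
    change k (r ^ (2 * j)) + k 0 ≠ 0 at h3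
    rw [hk0] at h3
    revert h1 h3
    generalize k (r ^ (2 * j)) = u
    revert u
    decide
  have sqiff : ∀ i m : ℕ, 1 ≤ m → m ≤ 5 → i + m < 6 →
      (IsSquare (r ^ (2 * m) - 1) ↔ k (r ^ (2 * (i + m))) = k (r ^ (2 * i))) := by
    intro i m hm1 hm5 him
    have hm0 := hrk m hm1 hm5
    have hne : r ^ (2 * (i + m)) ≠ r ^ (2 * i) := by
      rw [← sub_ne_zero, hsplit]
      exact mul_ne_zero hm0 (pow_ne_zero _ (pow_ne_zero _ hr0))
    have h1 := kr _ him
    have h3 := kr i (by omega)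
    have e := hs2 _ (mr _ him) _ (mr i (by omega)) hne
    rw [hsplit] at e
    change k (r ^ (2 * (i + m))) + k (r ^ (2 * i)) ≠ _ at e
    by_cases hsqr : IsSquare (r ^ (2 * m) - 1)
    · rw [k0 _ (mul_ne_zero hm0 (pow_ne_zero _ (pow_ne_zero _ hr0)))
        (hsqr.mul ⟨r ^ i, by ring⟩)] at e
      refine iff_of_true hsqr ?_
      revert e h1 h3
      generalize k (r ^ (2 * (i + m))) = u
      generalize k (r ^ (2 * i)) = v
      revert u v
      decide
    · rw [k2 _ (hmulsq _ _ hsqr (pow_ne_zero _ hr0))] at e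
      refine iff_of_false hsqr ?_
      revert e h1 h3
      generalize k (r ^ (2 * (i + m))) = u
      generalize k (r ^ (2 * i)) = v
      revert u v
      decide
  have d1 : ¬ IsSquare (r ^ (2 * 1) - 1) := hr1
  have q0 := sqiff 0 1 (by norm_num) (by norm_num) (by norm_num)
  have q1 := sqiff 1 1 (by norm_num) (by norm_num) (by norm_num)
  have q2 := sqiff 2 1 (by norm_num) (by norm_num) (by norm_num)
  have q3 := sqiff 3 1 (by norm_num) (by norm_num) (by norm_num)
  have q4 := sqiff 4 1 (by norm_num) (by norm_num) (by norm_num)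
  have s2 := sqiff 0 2 (by norm_num) (by norm_num) (by norm_num)
  have s3 := sqiff 0 3 (by norm_num) (by norm_num) (by norm_num)
  have s4 := sqiff 0 4 (by norm_num) (by norm_num) (by norm_num)
  have s5 := sqiff 0 5 (by norm_num) (by norm_num) (by norm_num)
  have t0 := kr 0 (by norm_num)
  have t1 := kr 1 (by norm_num)
  have t2 := kr 2 (by norm_num)
  have t3 := kr 3 (by norm_num)
  have t4 := kr 4 (by norm_num)
  have t5 := kr 5 (by norm_num)
  norm_num only at q0 q1 q2 q3 q4 s2 s3 s4 s5 t0 t1 t2 t3 t4 t5 d1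
  have tern : ∀ u v w : ZMod 4, (u = 1 ∨ u = 3) → (v = 1 ∨ v = 3) → (w = 1 ∨ w = 3) →
      v ≠ u → w ≠ v → w = u := by decide
  have g0 := fun h => d1 (q0.2 h)
  have g1 := fun h => d1 (q1.2 h)
  have g2 := fun h => d1 (q2.2 h)
  have g3 := fun h => d1 (q3.2 h)
  have g4 := fun h => d1 (q4.2 h)
  have w2 := tern _ _ _ t0 t1 t2 g0 g1
  have w3 := tern _ _ _ t1 t2 t3 g1 g2
  have w4 := tern _ _ _ t2 t3 t4 g2 g3
  have w5 := tern _ _ _ t3 t4 t5 g3 g4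
  have D2 : IsSquare (r ^ (2 * 2) - 1) := s2.2 w2
  have D3 : ¬ IsSquare (r ^ (2 * 3) - 1) := fun h => g0 (by rw [← w3]; exact s3.1 h)
  have D4 : IsSquare (r ^ (2 * 4) - 1) := s4.2 (by rw [w4, w2])
  have D5 : ¬ IsSquare (r ^ (2 * 5) - 1) := fun h => g0 (by rw [← w3, ← w5]; exact s5.1 h)
  have csplit : ∀ i m : ℕ, c * r ^ (2 * (i + m)) - c * r ^ (2 * i)
      = (c * (r ^ (2 * m) - 1)) * (r ^ i) ^ 2 := by
    intro i m; ring
  have cne : ∀ i m : ℕ, 1 ≤ m → m ≤ 5 → c * r ^ (2 * (i + m)) ≠ c * r ^ (2 * i) := by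
    intro i m h1 h5
    rw [← sub_ne_zero, csplit]
    exact mul_ne_zero (mul_ne_zero hc0 (hrk m h1 h5)) (pow_ne_zero _ (pow_ne_zero _ hr0))
  have cS : ∀ i m : ℕ, 1 ≤ m → m ≤ 5 → i + m < 6 → IsSquare (r ^ (2 * m) - 1) →
      k (c * r ^ (2 * (i + m))) + k (c * r ^ (2 * i)) ≠ 2 := by
    intro i m h1 h5 h6 hs
    have e := hs2 _ (mc _ h6) _ (mc i (by omega)) (cne i m h1 h5)
    rw [csplit, k2] at e
    · exact e
    · apply hmulsq _ _ _ (pow_ne_zero _ hr0)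
      obtain ⟨v, hv⟩ := hs
      rw [hv, ← sq]
      apply hmulsq _ _ hc
      rintro rfl
      exact hrk m h1 h5 (by rw [hv]; ring)
  have cN : ∀ i m : ℕ, 1 ≤ m → m ≤ 5 → i + m < 6 → ¬ IsSquare (r ^ (2 * m) - 1) →
      k (c * r ^ (2 * (i + m))) + k (c * r ^ (2 * i)) ≠ 0 := by
    intro i m h1 h5 h6 hs
    have e := hs2 _ (mc _ h6) _ (mc i (by omega)) (cne i m h1 h5)
    rw [csplit, k0] at e
    · exact e
    · exact mul_ne_zero (mul_ne_zero hc0 (hrk m h1 h5)) (pow_ne_zero _ (pow_ne_zero _ hr0))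
    · exact (hsq _ _ hc hs).mul ⟨r ^ i, by ring⟩
  have three : ∀ u v w : ZMod 4, u ≠ 0 → v ≠ 0 → w ≠ 0 → v + u ≠ 2 → w + v ≠ 2 → w + u ≠ 2 →
      u = 2 ∨ v = 2 ∨ w = 2 := by decide
  have two2 : ∀ u v : ZMod 4, u + v ≠ 0 → u = 2 → v = 2 → False := by decide
  have n : ∀ j < 6, k (c * r ^ (2 * j)) ≠ 0 := fun j hj => hs1 _ (mc j hj)
  have T1 := three _ _ _ (n 0 (by norm_num)) (n 2 (by norm_num)) (n 4 (by norm_num))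
    (cS 0 2 (by norm_num) (by norm_num) (by norm_num) D2)
    (cS 2 2 (by norm_num) (by norm_num) (by norm_num) D2)
    (cS 0 4 (by norm_num) (by norm_num) (by norm_num) D4)
  have T2 := three _ _ _ (n 1 (by norm_num)) (n 3 (by norm_num)) (n 5 (by norm_num))
    (cS 1 2 (by norm_num) (by norm_num) (by norm_num) D2)
    (cS 3 2 (by norm_num) (by norm_num) (by norm_num) D2)
    (cS 1 4 (by norm_num) (by norm_num) (by norm_num) D4)
  rcases T1 with a | a | a <;> rcases T2 with a' | a' | a'
  · exact two2 _ _ (cN 0 1 (by norm_num) (by norm_num) (by norm_num) hr1) a' a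
  · exact two2 _ _ (cN 0 3 (by norm_num) (by norm_num) (by norm_num) D3) a' a
  · exact two2 _ _ (cN 0 5 (by norm_num) (by norm_num) (by norm_num) D5) a' a
  · exact two2 _ _ (cN 1 1 (by norm_num) (by norm_num) (by norm_num) hr1) a a'
  · exact two2 _ _ (cN 2 1 (by norm_num) (by norm_num) (by norm_num) hr1) a' a
  · exact two2 _ _ (cN 2 3 (by norm_num) (by norm_num) (by norm_num) D3) a' a
  · exact two2 _ _ (cN 1 3 (by norm_num) (by norm_num) (by norm_num) D3) a a'
  · exact two2 _ _ (cN 3 1 (by norm_num) (by norm_num) (by norm_num) hr1) a a'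
  · exact two2 _ _ (cN 4 1 (by norm_num) (by norm_num) (by norm_num) hr1) a' a

/-- The affine points of `y ^ 2 = x ^ 3 + A x ^ 2 + B x + D`. -/
def CubicPts {K : Type} [Field K] (A B D : K) : Set (K × K) :=
  {p | p.2 ^ 2 = p.1 ^ 3 + A * p.1 ^ 2 + B * p.1 + D}

theorem pts_of_x {K : Type} [Field K] (A B D : K)
    (h : {x : K | IsSquare (x ^ 3 + A * x ^ 2 + B * x + D)}.Infinite) :
    (CubicPts A B D).Infinite := by
  intro hf
  refine h ((hf.image Prod.fst).subset ?_)
  rintro x ⟨y, hy⟩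
  exact ⟨(x, y), by show y ^ 2 = _; rw [hy]; ring, rfl⟩

theorem pts_shift {K : Type} [Field K] (A B D h : K)
    (hp : (CubicPts (A + 3 * h) (B + 2 * A * h + 3 * h ^ 2)
      (h ^ 3 + A * h ^ 2 + B * h + D)).Infinite) : (CubicPts A B D).Infinite := by
  have hinj : Function.Injective (fun p : K × K => (p.1 + h, p.2)) := by
    rintro ⟨x, y⟩ ⟨x', y'⟩ hh
    simp only [Prod.mk.injEq, add_left_inj] at hh
    exact Prod.ext hh.1 hh.2
  refine (hp.image hinj.injOn).mono ?_
  rintro _ ⟨⟨x, y⟩, hxy, rfl⟩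
  simp only [CubicPts, Set.mem_ofPred_eq] at hxy ⊢
  linear_combination hxy

theorem prod_sq {K : Type} [Field K]
    (hsq : ∀ a b : K, ¬ IsSquare a → ¬ IsSquare b → IsSquare (a * b)) (d : K) (hd : ¬ IsSquare d)
    (u v z : K) (h : u * v = d * z ^ 2) : IsSquare u ∨ IsSquare v := by
  by_contra hcon
  push Not at hcon
  obtain ⟨w, hw⟩ := hsq u v hcon.1 hcon.2
  have hu : u ≠ 0 := fun h => hcon.1 (h ▸ IsSquare.zero)
  have hv : v ≠ 0 := fun h => hcon.2 (h ▸ IsSquare.zero)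
  have hz : z ≠ 0 := by
    rintro rfl
    exact mul_ne_zero hu hv (by rw [h]; ring)
  apply hd
  refine ⟨w / z, ?_⟩
  field_simp
  linear_combination hw - h

/-- The generic case (twisted Mestre construction). -/
theorem case_generic {K : Type} [Field K] [Infinite K]
    (hsq : ∀ a b : K, ¬ IsSquare a → ¬ IsSquare b → IsSquare (a * b)) (d : K) (hd : ¬ IsSquare d)
    (a b : K) (ha : a ≠ 0) (hb : b ≠ 0) : (CubicPts 0 a b).Infinite := by
  apply pts_of_x
  intro hS
  have hd0 : d ≠ 0 := fun h => hd (h ▸ IsSquare.zero)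
  have E : ∀ᶠ t in (cofinite : Filter K), ∀ s ∈ {x : K | IsSquare (x ^ 3 + 0 * x ^ 2 + a * x + b)},
      (-(b + s * a) * d ^ 2) * (t ^ 2) ^ 2 + (-(b + s * a) * d) * t ^ 2 + (-b) ≠ 0 ∧
      (-b * d ^ 2) * (t ^ 2) ^ 2 + (-(b + s * a) * d) * t ^ 2 + -(b + s * a) ≠ 0 := by
    rw [Filter.eventually_all_finite hS]
    intro s _
    refine (ev_quad 2 two_ne_zero _ _ _ ?_).and (ev_quad 2 two_ne_zero _ _ _ ?_)
    · exact Or.inr (Or.inr (neg_ne_zero.2 hb))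
    · exact Or.inl (mul_ne_zero (neg_ne_zero.2 hb) (pow_ne_zero _ hd0))
  obtain ⟨t, ht, ht0, ht1⟩ := (E.and (ev_ne_zero.and
    (ev_quad 2 two_ne_zero (0 : K) d 1 (by simp)))).exists
  set m := d * t ^ 2 with hm
  have hm0 : m ≠ 0 := mul_ne_zero hd0 (pow_ne_zero _ ht0)
  have hm1 : m + 1 ≠ 0 := fun h => ht1 (by linear_combination h)
  set x := -b * (m ^ 2 + m + 1) / (a * m * (m + 1)) with hx
  have hxm : x * (a * m * (m + 1)) = -b * (m ^ 2 + m + 1) :=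
    div_mul_cancel₀ _ (mul_ne_zero (mul_ne_zero ha hm0) hm1)
  have e1 : (m * x) ^ 3 + 0 * (m * x) ^ 2 + a * (m * x) + b
      = m ^ 3 * (x ^ 3 + 0 * x ^ 2 + a * x + b) := by
    linear_combination (1 - m) * hxm
  have e2 : ((m * x) ^ 3 + 0 * (m * x) ^ 2 + a * (m * x) + b) * (x ^ 3 + 0 * x ^ 2 + a * x + b)
      = d * (d * t ^ 3 * (x ^ 3 + 0 * x ^ 2 + a * x + b)) ^ 2 := by
    rw [e1, hm]; ring
  rcases prod_sq hsq d hd _ _ _ e2 with h | h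
  · apply (ht (m * x) h).2
    have : (m * x) * (a * (m + 1)) = -b * (m ^ 2 + m + 1) := by linear_combination hxm
    rw [hm] at this ⊢
    linear_combination - this
  · apply (ht x h).1
    rw [hm] at hxm
    linear_combination - hxm

theorem case_j1728 {K : Type} [Field K] [Infinite K] (h2 : (2 : K) ≠ 0)
    (hsq : ∀ a b : K, ¬ IsSquare a → ¬ IsSquare b → IsSquare (a * b)) (d : K) (hd : ¬ IsSquare d)
    (a : K) (ha : a ≠ 0) : (CubicPts 0 a 0).Infinite := by
  by_cases hm1 : IsSquare (-1 : K)
  · have hinf := caseB h2 hm1 d hd hsq (a / 4)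
    intro hf
    apply hinf
    refine (hf.image (fun p : K × K => p.1 / 2 - (p.2 / (2 * p.1)) ^ 2)).subset ?_
    rintro x ⟨w, hw⟩
    have h4 : (4 : K) ≠ 0 := by
      have : (4 : K) = 2 * 2 := by norm_num
      rw [this]; exact mul_ne_zero h2 h2
    have hw' : 4 * x ^ 2 + a = 4 * w ^ 4 := by
      field_simp at hw
      linear_combination hw
    have hs : w ^ 2 + x ≠ 0 := by
      intro h
      apply ha
      linear_combination hw' + 4 * (w ^ 2 - x) * h
    refine ⟨(2 * (w ^ 2 + x), 4 * (w ^ 2 + x) * w), ?_, ?_⟩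
    · simp only [CubicPts, Set.mem_ofPred_eq]
      linear_combination (-2 * (w ^ 2 + x)) * hw'
    · show 2 * (w ^ 2 + x) / 2 - (4 * (w ^ 2 + x) * w / (2 * (2 * (w ^ 2 + x)))) ^ 2 = x
      have : 4 * (w ^ 2 + x) * w / (2 * (2 * (w ^ 2 + x))) = w := by
        field_simp; ring
      rw [this]
      field_simp
      ring
  · apply pts_of_x
    intro hf
    have hf2 := hf.union (hf.image (fun x => -x))
    refine Set.infinite_univ (hf2.subset ?_)
    intro x _
    by_cases hx : IsSquare (x ^ 3 + 0 * x ^ 2 + a * x + 0)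
    · exact Or.inl hx
    · right
      refine ⟨-x, ?_, by simp⟩
      have := hsq _ _ hm1 hx
      show IsSquare _
      convert this using 1
      ring

theorem case_linear_factor {K : Type} [Field K] [Infinite K]
    (hsq : ∀ a b : K, ¬ IsSquare a → ¬ IsSquare b → IsSquare (a * b)) (d : K) (hd : ¬ IsSquare d)
    (A B D e s n : K) (hA : A = -(e + s)) (hB : B = n + e * s) (hD : D = - e * n)
    (hs : s - 2 * e ≠ 0) : (CubicPts A B D).Infinite := by
  apply pts_of_x
  intro hS
  have hd0 : d ≠ 0 := fun h => hd (h ▸ IsSquare.zero)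
  have E : ∀ᶠ t in (cofinite : Filter K), ∀ z ∈ {x : K | IsSquare (x ^ 3 + A * x ^ 2 + B * x + D)},
      0 * (t ^ 2) ^ 2 + ((z - e) * d) * t ^ 2 + ((z - e) - (s - 2 * e)) ≠ 0 ∧
      0 * (t ^ 2) ^ 2 + ((s - z - e) * d) * t ^ 2 + ((s - z - e) - (s - 2 * e)) ≠ 0 := by
    rw [Filter.eventually_all_finite hS]
    intro z _
    have key : ∀ v : K, (v * d ≠ 0 ∨ v - (s - 2 * e) ≠ 0) := by
      intro v
      by_cases hv : v = 0
      · right; rw [hv, zero_sub]; exact neg_ne_zero.2 hs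
      · left; exact mul_ne_zero hv hd0
    exact (ev_quad 2 two_ne_zero _ _ _ (Or.inr (key _))).and
      (ev_quad 2 two_ne_zero _ _ _ (Or.inr (key _)))
  obtain ⟨t, ht, ht1⟩ := (E.and (ev_quad 2 two_ne_zero (0 : K) d 1 (by simp))).exists
  have hm1 : 1 + d * t ^ 2 ≠ 0 := fun h => ht1 (by linear_combination h)
  set p := (s - 2 * e) / (1 + d * t ^ 2) with hp
  have hpm : p * (1 + d * t ^ 2) = s - 2 * e := div_mul_cancel₀ _ hm1
  have fac : ∀ x, x ^ 3 + A * x ^ 2 + B * x + D = (x - e) * (x ^ 2 - s * x + n) := by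
    intro x; rw [hA, hB, hD]; ring
  have e2 : ((e + p) ^ 3 + A * (e + p) ^ 2 + B * (e + p) + D) *
      ((s - (e + p)) ^ 3 + A * (s - (e + p)) ^ 2 + B * (s - (e + p)) + D)
      = d * (t * p * ((e + p) ^ 2 - s * (e + p) + n)) ^ 2 := by
    rw [fac, fac]
    linear_combination (-p * ((e + p) ^ 2 - s * (e + p) + n) ^ 2) * hpm
  rcases prod_sq hsq d hd _ _ _ e2 with h | h
  · apply (ht _ h).1
    linear_combination hpm
  · apply (ht _ h).2
    linear_combination hpm

theorem case_char3_sqdisc {K : Type} [Field K] [Infinite K] (h3 : (3 : K) = 0)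
    (hsq : ∀ a b : K, ¬ IsSquare a → ¬ IsSquare b → IsSquare (a * b)) (d : K) (hd : ¬ IsSquare d)
    (A b w : K) (hw : w ≠ 0) (hAb : A = - b * w ^ 2) : (CubicPts A 0 b).Infinite := by
  apply pts_of_x
  intro hS
  have hd0 : d ≠ 0 := fun h => hd (h ▸ IsSquare.zero)
  have E : ∀ᶠ t in (cofinite : Filter K), ∀ z ∈ {x : K | IsSquare (x ^ 3 + A * x ^ 2 + 0 * x + b)},
      0 * (t ^ 2) ^ 2 + d * t ^ 2 + (- 1 - w * z) ≠ 0 ∧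
      0 * (t ^ 2) ^ 2 + (d - w * z * d) * t ^ 2 + (-1) ≠ 0 := by
    rw [Filter.eventually_all_finite hS]
    intro z _
    exact (ev_quad 2 two_ne_zero _ _ _ (by simp [hd0])).and
      (ev_quad 2 two_ne_zero _ _ _ (by simp))
  obtain ⟨t, ht, ht0⟩ := (E.and ev_ne_zero).exists
  set m := d * t ^ 2 with hm
  have hm0 : m ≠ 0 := mul_ne_zero hd0 (pow_ne_zero _ ht0)
  set x := (m - 1) / (m * w) with hx
  have hxm : x * (m * w) = m - 1 := div_mul_cancel₀ _ (mul_ne_zero hm0 hw)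
  have e1 : (m * x) ^ 3 + A * (m * x) ^ 2 + 0 * (m * x) + b
      = m ^ 3 * (x ^ 3 + A * x ^ 2 + 0 * x + b) := by
    have h1 : A * (m * x) ^ 2 = - b * (m - 1) ^ 2 := by
      rw [hAb, ← hxm]; ring
    linear_combination (1 - m) * h1 + b * (m - m ^ 2) * h3
  have e2 : ((m * x) ^ 3 + A * (m * x) ^ 2 + 0 * (m * x) + b) * (x ^ 3 + A * x ^ 2 + 0 * x + b)
      = d * (d * t ^ 3 * (x ^ 3 + A * x ^ 2 + 0 * x + b)) ^ 2 := by
    rw [e1, hm]; ring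
  rcases prod_sq hsq d hd _ _ _ e2 with h | h
  · apply (ht _ h).1
    linear_combination - hxm
  · apply (ht _ h).2
    rw [hm] at hxm
    linear_combination - hxm

theorem case_j0 {K : Type} [Field K] [Infinite K] (h2 : (2 : K) ≠ 0) (h3 : (3 : K) ≠ 0)
    (hcyc : IsCyclicField K) (b : K) : (CubicPts 0 0 b).Infinite := by
  have hinf : {x : K | ∃ w, x ^ 2 + (-b) = w ^ 3}.Infinite := by
    by_cases hall : ∀ x : K, ∃ w, x = w ^ 3
    · convert Set.infinite_univ (α := K)
      exact Set.eq_univ_of_forall fun x => hall _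
    · push Not at hall
      obtain ⟨c, hc⟩ := hall
      have hc0 : c ≠ 0 := by rintro rfl; exact hc 0 (by ring)
      have hcc : ¬ ∃ w, c = w ^ 3 := by rintro ⟨w, hw⟩; exact hc w hw
      have h27 : (27 : K) ≠ 0 := by
        have : (27 : K) = 3 ^ 3 := by norm_num
        rw [this]; exact pow_ne_zero _ h3
      obtain ⟨v, hv⟩ := disc_square hcyc 0 0 (-c) (by
        have : (0 : K) ^ 2 * 0 ^ 2 - 4 * 0 ^ 3 - 4 * 0 ^ 3 * -c - 27 * (-c) ^ 2 + 18 * 0 * 0 * -c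
          = - (27 * c ^ 2) := by ring
        rw [this]
        exact neg_ne_zero.2 (mul_ne_zero h27 (pow_ne_zero _ hc0))) (by
        intro x hx
        exact hc x (by linear_combination -hx))
      have hv' : v * v = - 27 * c ^ 2 := by rw [← hv]; ring
      have hz : ((v / (3 * c) - 1) / 2) ^ 2 + (v / (3 * c) - 1) / 2 + 1 = 0 := by
        field_simp
        linear_combination hv'
      obtain ⟨κ, hκ, hκc⟩ := exists_classFn 3 (by norm_num) c hc0 (by
        intro x hx
        by_cases hxc : ∃ w, x = w ^ 3
        · obtain ⟨w, hw⟩ := hxc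
          exact ⟨0, w, by rw [hw]; ring⟩
        · rcases cube_class h3 hcyc _ hz x c hxc hcc with ⟨w, hw⟩ | ⟨w, hw⟩
          · refine ⟨2, w / c, ?_⟩
            field_simp
            linear_combination hw
          · refine ⟨1, w / c, ?_⟩
            field_simp
            linear_combination hw) (by
        intro k w h
        by_contra hk
        have hr : k = 3 * (k / 3) + k % 3 := (Nat.div_add_mod k 3).symm
        have hlt : k % 3 = 1 ∨ k % 3 = 2 := by omega
        have hp := pow_ne_zero (k / 3) hc0
        rw [hr] at h
        rcases hlt with hh | hh <;> rw [hh] at h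
        · apply hcc
          refine ⟨w / c ^ (k / 3), ?_⟩
          rw [div_pow, ← h, eq_div_iff (pow_ne_zero _ hp)]
          ring
        · apply hcc
          have hw0 : w ≠ 0 := by
            rintro rfl
            exact pow_ne_zero (3 * (k / 3) + 2) hc0 (by rw [h]; ring)
          refine ⟨c ^ (k / 3) * c / w, ?_⟩
          rw [div_pow, ← h, eq_div_iff (pow_ne_zero _ hc0)]
          ring)
      exact caseA h2 h3 κ hκ c hc0 hκc (-b)
  intro hf
  refine hinf ((hf.image Prod.snd).subset ?_)
  rintro y ⟨w, hw⟩
  refine ⟨(w, y), ?_, rfl⟩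
  simp only [CubicPts, Set.mem_ofPred_eq]
  linear_combination hw

theorem case_char3_as {K : Type} [Field K] [Infinite K] (h3 : (3 : K) = 0)
    (hcyc : IsCyclicField K) (e b : K) (he : e ≠ 0)
    (hb : ¬ ∃ w, b = w ^ 3 - e ^ 2 * w) : (CubicPts 0 (-e ^ 2) b).Infinite := by
  have hchar : CharP K 3 := by
    have := CharP.ringChar_of_prime_eq_zero (R := K) Nat.prime_three (by exact_mod_cast h3)
    rw [← this]; exact ringChar.charP K
  letI : Algebra (ZMod 3) K := ZMod.algebra K 3
  let V : AddSubgroup K :=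
    { carrier := {z | ∃ w, z = w ^ 3 - e ^ 2 * w}
      zero_mem' := ⟨0, by ring⟩
      add_mem' := by
        rintro _ _ ⟨u, rfl⟩ ⟨v, rfl⟩
        exact ⟨u + v, by linear_combination (- u ^ 2 * v - u * v ^ 2) * h3⟩
      neg_mem' := by
        rintro _ ⟨u, rfl⟩
        exact ⟨-u, by ring⟩ }
  have hVmem : ∀ z, z ∈ V ↔ ∃ w, z = w ^ 3 - e ^ 2 * w := fun z => Iff.rfl
  let V' : Submodule (ZMod 3) K := AddSubgroup.toZModSubmodule 3 V
  have hbV : b ∉ V' := hb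
  obtain ⟨l, hl, hlV⟩ := Submodule.exists_le_ker_of_notMem hbV
  have hker : ∀ z, l z = 0 → ∃ w, z = w ^ 3 - e ^ 2 * w := by
    intro z hz
    by_contra hzV
    rcases as_class h3 hcyc e he z b hzV hb with h | h
    · have : l (z + b) = 0 := hlV ((hVmem _).2 h)
      rw [map_add, hz, zero_add] at this
      exact hl this
    · have : l (z - b) = 0 := hlV ((hVmem _).2 h)
      rw [map_sub, hz, zero_sub, neg_eq_zero] at this
      exact hl this
  have l2 : ∀ x : K, l (2 * x) = 2 * l x := by
    intro x; rw [two_mul, map_add, two_mul]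
  -- an isotropic vector
  obtain ⟨v, hv0, hv⟩ : ∃ v : K, v ≠ 0 ∧ l (v ^ 2) = 0 := by
    by_contra hcon
    push Not at hcon
    have pig : ∀ u : K, ∃ w : K, w ≠ 0 ∧ l w = 0 ∧ l (u * w) = 0 := by
      intro u
      obtain ⟨x, y, hxy, h⟩ := Finite.exists_ne_map_eq_of_infinite
        (fun x : K => (l x, l (u * x)))
      simp only [Prod.mk.injEq] at h
      refine ⟨x - y, sub_ne_zero.2 hxy, ?_, ?_⟩
      · rw [map_sub, h.1, sub_self]
      · rw [mul_sub, map_sub, h.2, sub_self]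
    obtain ⟨u, hu0, hu, -⟩ := pig 1
    obtain ⟨w, hw0, hw, huw⟩ := pig u
    have a1 := hcon 1 one_ne_zero
    have a2 := hcon u hu0
    have a3 := hcon w hw0
    rw [one_pow] at a1
    have b1 : 1 + u ≠ 0 := by
      intro h
      have h' := congrArg l h
      rw [map_add, hu, map_zero, add_zero] at h'
      exact a1 h'
    have b2 : 1 + w ≠ 0 := by
      intro h
      have h' := congrArg l h
      rw [map_add, hw, map_zero, add_zero] at h'
      exact a1 h'
    have b3 : 1 + u + w ≠ 0 := by
      intro h
      have h' := congrArg l h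
      rw [map_add, map_add, hu, hw, map_zero, add_zero, add_zero] at h'
      exact a1 h'
    have c1 := hcon _ b1
    have c2 := hcon _ b2
    have c3 := hcon _ b3
    have d1 : l ((1 + u) ^ 2) = l 1 + l (u ^ 2) := by
      have : (1 + u) ^ 2 = 1 + 2 * u + u ^ 2 := by ring
      rw [this, map_add, map_add, l2, hu]; ring
    have d2 : l ((1 + w) ^ 2) = l 1 + l (w ^ 2) := by
      have : (1 + w) ^ 2 = 1 + 2 * w + w ^ 2 := by ring
      rw [this, map_add, map_add, l2, hw]; ring
    have d3 : l ((1 + u + w) ^ 2) = l 1 + l (u ^ 2) + l (w ^ 2) := by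
      have : (1 + u + w) ^ 2 = 1 + u ^ 2 + w ^ 2 + 2 * u + 2 * w + 2 * (u * w) := by ring
      rw [this, map_add, map_add, map_add, map_add, map_add, l2, l2, l2, hu, hw, huw]; ring
    rw [d1] at c1
    rw [d2] at c2
    rw [d3] at c3
    revert a1 a2 a3 c1 c2 c3
    generalize l 1 = p
    generalize l (u ^ 2) = q
    generalize l (w ^ 2) = r
    revert p q r
    decide
  have hT : {y : K | l (y ^ 2) = l b}.Infinite := by
    intro hT
    obtain ⟨i, hi⟩ := Finite.exists_infinite_fiber (fun x : K => l (x * v))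
    have hi' : ((fun x : K => l (x * v)) ⁻¹' {i}).Infinite := Set.infinite_coe_iff.1 hi
    have hU : {x : K | l (x * v) ≠ 0}.Infinite := by
      by_cases hi0 : i = 0
      · have hinj : Function.Injective (fun x : K => x + b / v) := add_left_injective _
        refine (hi'.image hinj.injOn).mono ?_
        rintro _ ⟨x, hx, rfl⟩
        have hx' : l (x * v) = i := hx
        show l ((x + b / v) * v) ≠ 0
        rw [add_mul, map_add, hx', hi0, zero_add, div_mul_cancel₀ _ hv0]
        exact hl
      · refine hi'.mono ?_
        intro x hx
        have hx' : l (x * v) = i := hx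
        show l (x * v) ≠ 0
        rw [hx']; exact hi0
    have hfin := (hT.union (hT.image (fun y => y - v))).union (hT.image (fun y => y + v))
    refine hU (hfin.subset ?_)
    intro x hx
    have hx' : l (x * v) ≠ 0 := hx
    have f1 : l ((x + v) ^ 2) = l (x ^ 2) + 2 * l (x * v) := by
      have : (x + v) ^ 2 = x ^ 2 + 2 * (x * v) + v ^ 2 := by ring
      rw [this, map_add, map_add, l2, hv, add_zero]
    have f2 : l ((x - v) ^ 2) = l (x ^ 2) - 2 * l (x * v) := by
      have : (x - v) ^ 2 = x ^ 2 - 2 * (x * v) + v ^ 2 := by ring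
      rw [this, map_add, map_sub, l2, hv, add_zero]
    have : l (x ^ 2) = l b ∨ l ((x + v) ^ 2) = l b ∨ l ((x - v) ^ 2) = l b := by
      rw [f1, f2]
      revert hx'
      generalize l (x * v) = p
      generalize l (x ^ 2) = q
      generalize l b = r
      revert p q r
      decide
    rcases this with h | h | h
    · exact Or.inl (Or.inl h)
    · exact Or.inl (Or.inr ⟨x + v, h, by simp⟩)
    · exact Or.inr ⟨x - v, h, by simp⟩
  intro hf
  refine hT ((hf.image Prod.snd).subset ?_)
  intro y hy
  have hy' : l (y ^ 2) = l b := hy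
  obtain ⟨w, hw⟩ := hker (y ^ 2 - b) (by rw [map_sub, hy', sub_self])
  refine ⟨(w, y), ?_, rfl⟩
  simp only [CubicPts, Set.mem_ofPred_eq]
  linear_combination hw

theorem main_cubic {K : Type} [Field K] [Infinite K] (h2 : (2 : K) ≠ 0)
    (hcyc : IsCyclicField K) (A B D : K)
    (hdisc : A ^ 2 * B ^ 2 - 4 * B ^ 3 - 4 * A ^ 3 * D - 27 * D ^ 2 + 18 * A * B * D ≠ 0) :
    (CubicPts A B D).Infinite := by
  have hsq := sq_class h2 hcyc
  by_cases hall : ∀ x : K, IsSquare x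
  · apply pts_of_x
    convert Set.infinite_univ (α := K)
    exact Set.eq_univ_of_forall fun x => hall _
  push Not at hall
  obtain ⟨d, hd⟩ := hall
  by_cases h3 : (3 : K) = 0
  · have h27 : (27 : K) = 0 := by linear_combination 9 * h3
    have h18 : (18 : K) = 0 := by linear_combination 6 * h3
    by_cases hA : A = 0
    · subst hA
      have hB : B ≠ 0 := by
        rintro rfl
        apply hdisc
        linear_combination (-D ^ 2) * h27
      by_cases hroot : ∃ x, x ^ 3 + 0 * x ^ 2 + B * x + D = 0
      · obtain ⟨x, hx⟩ := hroot
        apply pts_shift 0 B D x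
        have e1 : (0 : K) + 3 * x = 0 := by rw [h3]; ring
        have e2 : B + 2 * 0 * x + 3 * x ^ 2 = B := by rw [h3]; ring
        rw [e1, e2, hx]
        exact case_j1728 h2 hsq d hd B hB
      · push Not at hroot
        obtain ⟨v, hv⟩ := disc_square hcyc 0 B D hdisc hroot
        have hv' : v * v = - 4 * B ^ 3 := by
          rw [← hv]; linear_combination (-D ^ 2) * h27
        have h4 : (4 : K) ≠ 0 := by
          have : (4 : K) = 2 * 2 := by norm_num
          rw [this]; exact mul_ne_zero h2 h2
        have hv0 : v ≠ 0 := by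
          rintro rfl
          apply mul_ne_zero h4 (pow_ne_zero 3 hB)
          linear_combination hv'
        have hBe : B = - (v / (2 * B)) ^ 2 := by
          field_simp
          linear_combination hv'
        have := case_char3_as h3 hcyc (v / (2 * B)) D (div_ne_zero hv0 (mul_ne_zero h2 hB)) (by
          rintro ⟨w, hw⟩
          apply hroot (-w)
          rw [hw]
          linear_combination (-w) * hBe)
        rwa [← hBe] at this
    · -- shift to kill the linear term
      set h := - B / (2 * A) with hh
      apply pts_shift A B D h
      have e1 : A + 3 * h = A := by rw [h3]; ring
      have hlin : B + 2 * A * h = 0 := by rw [hh]; field_simp; ring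
      have e2 : B + 2 * A * h + 3 * h ^ 2 = 0 := by rw [hlin, h3]; ring
      rw [e1, e2]
      set b := h ^ 3 + A * h ^ 2 + B * h + D with hb
      have hdisc' : A ^ 2 * 0 ^ 2 - 4 * 0 ^ 3 - 4 * A ^ 3 * b - 27 * b ^ 2 + 18 * A * 0 * b ≠ 0 := by
        intro h0
        apply hdisc
        have hB : B = - (2 * A * h) := by linear_combination hlin
        rw [hb, hB] at h0
        rw [hB]
        linear_combination h0 + (12 * A ^ 3 * h ^ 3 - 12 * A ^ 2 * h * D + 0) * h3 - (D ^ 2) * h27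
          + (h ^ 3 - A * h ^ 2 + D) ^ 2 * h27
      have hb0 : b ≠ 0 := by
        intro h0
        apply hdisc'
        rw [h0]; ring
      by_cases hroot : ∃ x, x ^ 3 + A * x ^ 2 + 0 * x + b = 0
      · obtain ⟨x, hx⟩ := hroot
        refine case_linear_factor hsq d hd A 0 b x (-A - x) (x * (A + x)) (by ring) (by ring)
          (by linear_combination hx) ?_
        intro h0
        apply hA
        linear_combination - h0 - x * h3
      · push Not at hroot
        obtain ⟨v, hv⟩ := disc_square hcyc A 0 b hdisc' hroot
        have hv' : v * v = - 4 * A ^ 3 * b := by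
          rw [← hv]; linear_combination (-b ^ 2) * h27
        have hv0 : v ≠ 0 := by
          rintro rfl
          apply hdisc'
          rw [hv]; ring
        refine case_char3_sqdisc h3 hsq d hd A b (v / (2 * A * b))
          (div_ne_zero hv0 (mul_ne_zero (mul_ne_zero h2 hA) hb0)) ?_
        field_simp
        linear_combination hv'
  · apply pts_shift A B D (- A / 3)
    have e1 : A + 3 * (- A / 3) = 0 := by field_simp; ring
    rw [e1]
    set a := B + 2 * A * (-A / 3) + 3 * (-A / 3) ^ 2 with ha
    set b := (-A / 3) ^ 3 + A * (-A / 3) ^ 2 + B * (-A / 3) + D with hb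
    have hab : A ^ 2 * B ^ 2 - 4 * B ^ 3 - 4 * A ^ 3 * D - 27 * D ^ 2 + 18 * A * B * D
        = - 4 * a ^ 3 - 27 * b ^ 2 := by
      rw [ha, hb]; field_simp; ring
    by_cases ha0 : a = 0
    · rw [ha0]
      exact case_j0 h2 h3 hcyc b
    · by_cases hb0 : b = 0
      · rw [hb0]
        exact case_j1728 h2 hsq d hd a ha0
      · exact case_generic hsq d hd a b ha0 hb0

theorem stmt0 (K : Type) [Field K] [Infinite K] (h2 : ringChar K ≠ 2)
    (hcyc : IsCyclicField K) (W : WeierstrassCurve K) (hΔ : W.Δ ≠ 0) :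
    Infinite W.toAffine.Point := by
  have h2' : (2 : K) ≠ 0 := Ring.two_ne_zero h2
  have h4 : (4 : K) ≠ 0 := by
    have : (4 : K) = 2 * 2 := by norm_num
    rw [this]; exact mul_ne_zero h2' h2'
  have key := main_cubic h2' hcyc (W.b₂ / 4) (W.b₄ / 2) (W.b₆ / 4) (by
    intro h
    apply hΔ
    have : W.Δ = 16 * ((W.b₂ / 4) ^ 2 * (W.b₄ / 2) ^ 2 - 4 * (W.b₄ / 2) ^ 3
        - 4 * (W.b₂ / 4) ^ 3 * (W.b₆ / 4) - 27 * (W.b₆ / 4) ^ 2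
        + 18 * (W.b₂ / 4) * (W.b₄ / 2) * (W.b₆ / 4)) := by
      have hrel := W.b_relation
      rw [WeierstrassCurve.Δ]
      field_simp
      linear_combination (-128 * W.b₂ ^ 2) * hrel
    rw [this, h, mul_zero])
  have hfun : ∀ p ∈ CubicPts (W.b₂ / 4) (W.b₄ / 2) (W.b₆ / 4),
      W.toAffine.Nonsingular p.1 (p.2 - (W.a₁ * p.1 + W.a₃) / 2) := by
    rintro ⟨x, y⟩ hp
    rw [← WeierstrassCurve.Affine.equation_iff_nonsingular_of_Δ_ne_zero hΔ,
      WeierstrassCurve.Affine.equation_iff]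
    simp only [CubicPts, Set.mem_ofPred_eq, WeierstrassCurve.b₂, WeierstrassCurve.b₄,
      WeierstrassCurve.b₆] at hp ⊢
    field_simp at hp ⊢
    apply mul_left_cancel₀ h2'
    linear_combination hp
  have := key.to_subtype
  refine Infinite.of_injective (fun p : CubicPts (W.b₂ / 4) (W.b₄ / 2) (W.b₆ / 4) =>
    WeierstrassCurve.Affine.Point.some _ _ (hfun p.1 p.2)) ?_
  rintro ⟨⟨x, y⟩, hp⟩ ⟨⟨x', y'⟩, hp'⟩ h
  simp only [WeierstrassCurve.Affine.Point.some.injEq] at h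
  obtain ⟨rfl, h⟩ := h
  have : y = y' := by linear_combination h
  subst this
  rfl
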